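/- Let T be a finite subset of a finite type U with distinct elements x, y ∈ U such that exactly one of x, y lies in T and |T| ≥ 2. Then ψ_T − ⟨v₊, ψ_T⟩ v₊ − ⟨v₋, ψ_T⟩ v₋ = √((|T|−1)/|T|) · ψ_{T \ {x,y}}; in particular, normalizing this residual yields exactly ψ_{T \ {x,y}}. -/

import Mathlib

open scoped InnerProductSpace

/-- `ψ_T = (1/√|T|) · ∑_{t∈T} e_t` in `ℂ^U`. -/
noncomputable def psi {U : Type*} [Fintype U] [DecidableEq U] (T : Finset U) :
    EuclideanSpace ℂ U :=
  ((Real.sqrt T.card : ℂ))⁻¹ • ∑ t ∈ T, EuclideanSpace.single t (1 : ℂ)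

/-- `v₊ = (e_x + e_y)/√2`. -/
noncomputable def vplus {U : Type*} [Fintype U] [DecidableEq U] (x y : U) :
    EuclideanSpace ℂ U :=
  ((Real.sqrt 2 : ℂ))⁻¹ • (EuclideanSpace.single x (1 : ℂ) + EuclideanSpace.single y (1 : ℂ))

/-- `v₋ = (e_x − e_y)/√2`. -/
noncomputable def vminus {U : Type*} [Fintype U] [DecidableEq U] (x y : U) :
    EuclideanSpace ℂ U :=
  ((Real.sqrt 2 : ℂ))⁻¹ • (EuclideanSpace.single x (1 : ℂ) - EuclideanSpace.single y (1 : ℂ))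

theorem psi_apply {U : Type*} [Fintype U] [DecidableEq U] (T : Finset U) (u : U) :
    psi T u = if u ∈ T then ((Real.sqrt T.card : ℂ))⁻¹ else 0 := by
  simp [psi, Finset.sum_apply, Pi.single_apply]

theorem norm_psi {U : Type*} [Fintype U] [DecidableEq U] {T : Finset U} (hT : T.Nonempty) :
    ‖psi T‖ = 1 := by
  have hc : (T.card : ℝ) ≠ 0 := by exact_mod_cast hT.card_pos.ne'
  rw [EuclideanSpace.norm_eq, Real.sqrt_eq_one]
  simp [psi_apply, apply_ite, hc, Finset.sum_ite_mem]

theorem inner_vplus_smul_add_inner_vminus_smul {U : Type*} [Fintype U] [DecidableEq U]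
    (x y : U) (φ : EuclideanSpace ℂ U) :
    ⟪vplus x y, φ⟫_ℂ • vplus x y + ⟪vminus x y, φ⟫_ℂ • vminus x y
      = EuclideanSpace.single x (φ x) + EuclideanSpace.single y (φ y) := by
  have h2 : ((Real.sqrt 2 : ℂ))⁻¹ * ((Real.sqrt 2 : ℂ))⁻¹ = 1 / 2 := by
    rw [← mul_inv, ← Complex.ofReal_mul, Real.mul_self_sqrt (by norm_num)]
    norm_num
  have hx : EuclideanSpace.single x (φ x) = φ x • EuclideanSpace.single x (1 : ℂ) := by
    ext u; simp
  have hy : EuclideanSpace.single y (φ y) = φ y • EuclideanSpace.single y (1 : ℂ) := by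
    ext u; simp
  rw [hx, hy]
  simp only [vplus, vminus, inner_smul_left, inner_add_left, inner_sub_left,
    EuclideanSpace.inner_single_left, map_inv₀, Complex.conj_ofReal, map_one, one_mul]
  linear_combination (norm := module) (2 * h2) •
    (φ x • EuclideanSpace.single x (1 : ℂ) + φ y • EuclideanSpace.single y (1 : ℂ))

theorem psi_sub_inner_smul_eq {U : Type*} [Fintype U] [DecidableEq U] (T : Finset U) {x y : U}
    (hxy : x ≠ y) :
    psi T - ⟪vplus x y, psi T⟫_ℂ • vplus x y - ⟪vminus x y, psi T⟫_ℂ • vminus x y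
      = ((Real.sqrt (((T \ {x, y}).card : ℝ) / (T.card : ℝ)) : ℂ)) • psi (T \ {x, y}) := by
  rw [sub_sub, inner_vplus_smul_add_inner_vminus_smul]
  ext u
  simp only [PiLp.sub_apply, PiLp.add_apply, PiLp.smul_apply, PiLp.single_apply,
    psi_apply, smul_eq_mul]
  by_cases hu : u ∈ T \ {x, y}
  · have hc : (Real.sqrt (T \ {x, y}).card : ℂ) ≠ 0 := by
      rw [Complex.ofReal_ne_zero, Real.sqrt_ne_zero']
      exact_mod_cast Finset.card_pos.mpr ⟨u, hu⟩
    have hu' := hu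
    simp only [Finset.mem_sdiff, Finset.mem_insert, Finset.mem_singleton, not_or] at hu'
    rw [Real.sqrt_div (Nat.cast_nonneg _), Complex.ofReal_div, if_pos hu]
    simp only [hu'.1, hu'.2.1, hu'.2.2, if_true, if_false]
    field_simp
    simp
  · rw [if_neg hu]
    simp only [Finset.mem_sdiff, Finset.mem_insert, Finset.mem_singleton] at hu
    grind

/-- If exactly one of `x, y` lies in `T` and `|T| ≥ 2`, then the residual of `ψ_T` after
projecting away the spans of `v₊` and `v₋` equals `√((|T|−1)/|T|) · ψ_{T \ {x,y}}`;
in particular, normalizing it yields `ψ_{T \ {x,y}}`. -/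
theorem psi_residual_pair_one_mem {U : Type*} [Fintype U] [DecidableEq U] (T : Finset U)
    (x y : U) (hxy : x ≠ y) (hone : (({x, y} : Finset U) ∩ T).card = 1)
    (hT : 2 ≤ T.card) :
    psi T - ⟪vplus x y, psi T⟫_ℂ • vplus x y - ⟪vminus x y, psi T⟫_ℂ • vminus x y
        = ((Real.sqrt (((T.card : ℝ) - 1) / (T.card : ℝ)) : ℂ)) • psi (T \ {x, y}) ∧
      ‖psi T - ⟪vplus x y, psi T⟫_ℂ • vplus x y - ⟪vminus x y, psi T⟫_ℂ • vminus x y‖⁻¹ •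
          (psi T - ⟪vplus x y, psi T⟫_ℂ • vplus x y - ⟪vminus x y, psi T⟫_ℂ • vminus x y)
        = psi (T \ {x, y}) := by
  have hcard : ((T \ {x, y}).card : ℝ) = (T.card : ℝ) - 1 := by
    rw [Finset.card_sdiff, hone, Nat.cast_sub (by lia), Nat.cast_one]
  have hT' : (2 : ℝ) ≤ T.card := by exact_mod_cast hT
  have hne : (T \ {x, y}).Nonempty := by
    rw [← Finset.card_pos, ← Nat.cast_pos (α := ℝ), hcard]
    linarith
  have hs : 0 < Real.sqrt (((T.card : ℝ) - 1) / (T.card : ℝ)) :=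
    Real.sqrt_pos.mpr (div_pos (by linarith) (by linarith))
  have key := psi_sub_inner_smul_eq T hxy
  rw [hcard] at key
  refine ⟨key, ?_⟩
  rw [key, Complex.coe_smul, norm_smul, norm_psi hne, mul_one, Real.norm_of_nonneg hs.le,
    inv_smul_smul₀ hs.ne']
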